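/- arXiv:1508.05712 — 2 statements merged into one kernel-verified Lean document; each statement's English description precedes it below -/
import Mathlib

section
/- Let k be a field of characteristic zero, let R = k[x₁, x₂, x₃, x₄, y₁₂, y₁₃, y₁₄, y₂₃, y₂₄, y₃₄] be the polynomial ring in 10 variables with the standard ℤ-grading (all variables of degree 1), and let I ⊂ R be the ideal generated by the five quadrics y₁₂y₃₄ − y₁₃y₂₄ + y₁₄y₂₃, x₂y₁₂ − x₃y₁₃ + x₄y₁₄, x₁y₁₂ − x₃y₂₃ + x₄y₂₄, x₁y₁₃ − x₂y₂₃ + x₄y₃₄, x₁y₁₄ − x₂y₂₄ + x₃y₃₄ (the 4×4 Pfaffians of the skew-symmetric matrix M with M₀₁ = x₁, M₀₂ = x₂, M₀₃ = x₃, M₀₄ = x₄, M₁₂ = y₃₄, M₁₃ = y₂₄, M₁₄ = y₂₃, M₂₃ = y₁₄, M₂₄ = y₁₃, M₃₄ = y₁₂). Then for every integer t ≥ 0, the k-vector-space dimension of the degree-t graded component of R/I (i.e., of the image in R/I of the space of homogeneous degree-t polynomials) equals (5t⁶ + 75t⁵ + 455t⁴ + 1425t³ + 2420t² + 2100t + 720)/720.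 -/
open MvPolynomial

/-- The polynomial ring `k[x₁, x₂, x₃, x₄, y₁₂, y₁₃, y₁₄, y₂₃, y₂₄, y₃₄]`,
with variables indexed by `Fin 10` in the order
`x₁, x₂, x₃, x₄, y₁₂, y₁₃, y₁₄, y₂₃, y₂₄, y₃₄`. -/
abbrev CoxRing5Ambient (k : Type*) [Field k] := MvPolynomial (Fin 10) k

/-- The ideal generated by the five quadrics
`y₁₂y₃₄ − y₁₃y₂₄ + y₁₄y₂₃`, `x₂y₁₂ − x₃y₁₃ + x₄y₁₄`, `x₁y₁₂ − x₃y₂₃ + x₄y₂₄`,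
`x₁y₁₃ − x₂y₂₃ + x₄y₃₄`, `x₁y₁₄ − x₂y₂₄ + x₃y₃₄` (the 4×4 Pfaffians of the
skew-symmetric matrix `M` with `M₀₁ = x₁, M₀₂ = x₂, M₀₃ = x₃, M₀₄ = x₄,
M₁₂ = y₃₄, M₁₃ = y₂₄, M₁₄ = y₂₃, M₂₃ = y₁₄, M₂₄ = y₁₃, M₃₄ = y₁₂`). -/
noncomputable def coxIdeal5 (k : Type*) [Field k] : Ideal (CoxRing5Ambient k) :=
  Ideal.span
    {X 4 * X 9 - X 5 * X 8 + X 6 * X 7,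
     X 1 * X 4 - X 2 * X 5 + X 3 * X 6,
     X 0 * X 4 - X 2 * X 7 + X 3 * X 8,
     X 0 * X 5 - X 1 * X 7 + X 3 * X 9,
     X 0 * X 6 - X 1 * X 8 + X 2 * X 9}

open Finset in
/-- The number of monomials of degree `t` in the variables `s` divisible by a fixed squarefree
monomial `∏ i ∈ r, X i`. -/
lemma card_filter_finsuppAntidiag_ne_zero {σ : Type*} [DecidableEq σ] {s r : Finset σ}
    (hrs : r ⊆ s) (hr : #r ≤ #s - 1) (hs : s.Nonempty) (t : ℕ) :
    #{m ∈ s.finsuppAntidiag t | ∀ i ∈ r, m i ≠ 0} = (t + (#s - 1) - #r).choose (#s - 1) := by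
  have hs' : 0 < #s := hs.card_pos
  set e : σ →₀ ℕ := Finsupp.indicator r fun _ _ ↦ 1 with he
  have he_apply (i : σ) : e i = if i ∈ r then 1 else 0 := by simp [he, Finsupp.indicator_apply]
  have he_sum : ∑ i ∈ s, e i = #r := by
    simp_rw [he_apply]
    rw [sum_ite_mem, inter_eq_right.2 hrs, sum_const, smul_eq_mul, mul_one]
  have he_supp : e.support ⊆ s := fun i hi ↦ by
    rw [Finsupp.mem_support_iff, he_apply] at hi
    exact hrs (by_contra fun h ↦ hi (if_neg h))
  rcases lt_or_ge t (#r) with ht | ht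
  · rw [Nat.choose_eq_zero_of_lt (by omega), card_eq_zero, filter_eq_empty_iff]
    intro m hm h
    rw [mem_finsuppAntidiag] at hm
    have : ∑ i ∈ s, e i ≤ ∑ i ∈ s, m i := sum_le_sum fun i _ ↦ by
      rw [he_apply]
      split_ifs with hi
      · exact Nat.one_le_iff_ne_zero.2 (h i hi)
      · exact Nat.zero_le _
    rw [he_sum, hm.1] at this
    exact absurd this (not_le.2 ht)
  · obtain ⟨n, rfl⟩ := Nat.exists_eq_add_of_le' ht
    have : {m ∈ s.finsuppAntidiag (n + #r) | ∀ i ∈ r, m i ≠ 0} =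
        (s.finsuppAntidiag n).map (addRightEmbedding e) := by
      ext m
      simp only [mem_filter, mem_finsuppAntidiag, mem_map, addRightEmbedding_apply]
      constructor
      · rintro ⟨⟨hsum, hsupp⟩, h⟩
        have hle : e ≤ m := fun i ↦ by
          rw [he_apply]
          split_ifs with hi
          · exact Nat.one_le_iff_ne_zero.2 (h i hi)
          · exact Nat.zero_le _
        refine ⟨m - e, ⟨?_, ?_⟩, tsub_add_cancel_of_le hle⟩
        · have h2 : ∑ i ∈ s, ((m - e) i + e i) = n + #r := by
            rw [← hsum]
            exact sum_congr rfl fun i _ ↦ by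
              rw [← Finsupp.add_apply, tsub_add_cancel_of_le hle]
          rw [sum_add_distrib, he_sum] at h2
          exact Nat.add_right_cancel h2
        · exact Finsupp.support_tsub.trans hsupp
      · rintro ⟨m, ⟨hsum, hsupp⟩, rfl⟩
        refine ⟨⟨?_, ?_⟩, fun i hi ↦ ?_⟩
        · rw [← hsum, ← he_sum, ← sum_add_distrib]
          rfl
        · exact Finsupp.support_add.trans (union_subset hsupp he_supp)
        · simp [he_apply, hi]
    rw [this, card_map, card_finsuppAntidiag_nat_eq_choose]
    by_cases hn : n = 0
    · subst hn
      simp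
    · rw [show n + #r + (#s - 1) - #r = #s + n - 1 by omega, ← Nat.choose_symm (by omega)]
      congr 1
      omega

/-- A monomial is standard if it is divisible by none of the products of two incomparable
Plücker coordinates. -/
def IsStandardExponent (m : Fin 10 →₀ ℕ) : Prop :=
  (m 2 = 0 ∨ m 9 = 0) ∧ (m 3 = 0 ∨ m 9 = 0) ∧ (m 3 = 0 ∨ m 8 = 0) ∧ (m 3 = 0 ∨ m 6 = 0) ∧
    (m 6 = 0 ∨ m 7 = 0)

instance : DecidablePred IsStandardExponent := fun m ↦ by
  unfold IsStandardExponent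
  infer_instance

/-- The exponents of the standard monomials of degree `t`. -/
def standardExponents (t : ℕ) : Finset (Fin 10 →₀ ℕ) :=
  {m ∈ (Finset.univ : Finset (Fin 10)).finsuppAntidiag t | IsStandardExponent m}

lemma mem_standardExponents {t : ℕ} {m : Fin 10 →₀ ℕ} :
    m ∈ standardExponents t ↔ m.degree = t ∧ IsStandardExponent m := by
  simp [standardExponents, Finsupp.degree_eq_sum]

/-- The maximal chains of Plücker coordinates. -/
def maximalChain : Fin 5 → Finset (Fin 10) :=
  ![{0, 1, 4, 5, 2, 7, 8}, {0, 1, 4, 5, 2, 7, 3}, {0, 1, 4, 5, 7, 8, 9}, {0, 1, 4, 5, 2, 8, 6},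
    {0, 1, 4, 5, 8, 6, 9}]

/-- The restriction sets of a shelling of the complex of chains of Plücker coordinates. -/
def chainRestriction : Fin 5 → Finset (Fin 10) :=
  ![∅, {3}, {9}, {6}, {6, 9}]

open Finset in
lemma standardExponents_eq_biUnion (t : ℕ) :
    standardExponents t = univ.biUnion fun i ↦
      {m ∈ (maximalChain i).finsuppAntidiag t | ∀ j ∈ chainRestriction i, m j ≠ 0} := by
  ext m
  have key (s : Finset (Fin 10)) : m ∈ s.finsuppAntidiag t ↔
      m.degree = t ∧ ∀ i ∉ s, m i = 0 := by
    rw [mem_finsuppAntidiag, Finsupp.degree_eq_sum]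
    have h : m.support ⊆ s ↔ ∀ i ∉ s, m i = 0 := by
      simp only [subset_iff, Finsupp.mem_support_iff, not_imp_comm]
    rw [h]
    refine and_congr_left fun h ↦ ?_
    rw [sum_subset (subset_univ s) fun i _ hi ↦ h i hi]
  simp only [mem_standardExponents, mem_biUnion, mem_filter, key, mem_univ, true_and,
    IsStandardExponent, Fin.exists_fin_succ, Fin.forall_fin_succ, maximalChain, chainRestriction]
  simp
  grind

open Finset in
lemma pairwiseDisjoint_chains (t : ℕ) :
    ((univ : Finset (Fin 5)) : Set (Fin 5)).PairwiseDisjoint fun i ↦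
      {m ∈ (maximalChain i).finsuppAntidiag t | ∀ j ∈ chainRestriction i, m j ≠ 0} := by
  have separated : ∀ i j, i ≠ j → (∃ v ∈ chainRestriction i, v ∉ maximalChain j) ∨
      ∃ v ∈ chainRestriction j, v ∉ maximalChain i := by decide
  intro i _ j _ hij
  rw [Function.onFun, disjoint_left]
  intro m hi hj
  simp only [mem_filter, mem_finsuppAntidiag] at hi hj
  rcases separated i j hij with ⟨v, hv, hv'⟩ | ⟨v, hv, hv'⟩
  · exact hv' (hj.1.2 (Finsupp.mem_support_iff.2 (hi.2 v hv)))
  · exact hv' (hi.1.2 (Finsupp.mem_support_iff.2 (hj.2 v hv)))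

lemma card_standardExponents (t : ℕ) :
    (standardExponents t).card = (t + 6).choose 6 + 3 * (t + 5).choose 6 + (t + 4).choose 6 := by
  have card_chain (i) : (maximalChain i).card = 7 := by revert i; decide
  have card_restriction (i) : (chainRestriction i).card = ![0, 1, 1, 1, 2] i := by
    revert i; decide
  have subset (i) : chainRestriction i ⊆ maximalChain i := by revert i; decide
  have card_le (i) : (chainRestriction i).card ≤ (maximalChain i).card - 1 := by
    revert i; decide
  rw [standardExponents_eq_biUnion, Finset.card_biUnion (pairwiseDisjoint_chains t)]
  have h (i) := card_filter_finsuppAntidiag_ne_zero (subset i) (card_le i)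
    (Finset.card_pos.1 (by rw [card_chain]; norm_num)) t
  rw [Finset.sum_congr rfl fun i _ ↦ (by convert h i)]
  simp only [card_chain, card_restriction, Fin.sum_univ_five]
  simp
  ring

lemma mul_card_standardExponents (t : ℕ) :
    720 * (standardExponents t).card =
      5 * t ^ 6 + 75 * t ^ 5 + 455 * t ^ 4 + 1425 * t ^ 3 + 2420 * t ^ 2 + 2100 * t + 720 := by
  have h (n : ℕ) : 720 * n.choose 6 = n.descFactorial 6 :=
    (Nat.descFactorial_eq_factorial_mul_choose n 6).symm
  rw [card_standardExponents, mul_add, mul_add, mul_left_comm, h, h, h]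
  cases t with
  | zero => decide
  | succ n =>
    simp only [Nat.descFactorial, show ∀ a b : ℕ, n + 1 + a - b = n + (1 + a) - b by grind]
    simp only [Nat.reduceAdd, Nat.reduceSubDiff, Nat.add_sub_cancel, Nat.sub_zero]
    ring

/-- The smaller column index of a Plücker coordinate. -/
def pluckerFst : Fin 10 → Fin 10 := ![0, 0, 0, 0, 3, 2, 2, 1, 1, 1]

/-- The larger column index of a Plücker coordinate. -/
def pluckerSnd : Fin 10 → Fin 10 := ![1, 2, 3, 4, 4, 4, 3, 4, 3, 2]

section

variable (k : Type*) [Field k]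

/-- The `2 × 2` minors of the generic `2 × 5` matrix, whose rows are `X 0, …, X 4` and
`X 5, …, X 9`. -/
noncomputable def pluckerMinor (i : Fin 10) : MvPolynomial (Fin 10) k :=
  X (pluckerFst i) * X (pluckerSnd i + 5) - X (pluckerSnd i) * X (pluckerFst i + 5)

/-- The leading exponent of a Plücker minor. -/
noncomputable def pluckerExponent (i : Fin 10) : Fin 10 →₀ ℕ :=
  Finsupp.single (pluckerFst i) 1 + Finsupp.single (pluckerSnd i + 5) 1

lemma degree_pluckerMinor (i : Fin 10) :
    MonomialOrder.lex.degree (pluckerMinor k i) = pluckerExponent i := by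
  have h (a b : Fin 10) : MonomialOrder.lex.degree (X a * X b : MvPolynomial (Fin 10) k) =
      Finsupp.single a 1 + Finsupp.single b 1 := by
    rw [MonomialOrder.degree_mul (X_ne_zero a) (X_ne_zero b), MonomialOrder.degree_X,
      MonomialOrder.degree_X]
  rw [pluckerMinor, MonomialOrder.degree_sub_of_lt, h, pluckerExponent]
  rw [h, h, MonomialOrder.lex_lt_iff, Finsupp.Lex.lt_iff]
  have h_lt : ∀ i, ∀ j < pluckerFst i, pluckerSnd i ≠ j ∧ pluckerFst i + 5 ≠ j ∧
      pluckerSnd i + 5 ≠ j := by decide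
  have h_ne : ∀ i, pluckerSnd i ≠ pluckerFst i ∧ pluckerFst i + 5 ≠ pluckerFst i ∧
      pluckerSnd i + 5 ≠ pluckerFst i := by decide
  refine ⟨pluckerFst i, fun j hj ↦ ?_, ?_⟩
  · simp [h_lt i j hj, hj.ne']
  · simp [h_ne i]

lemma pluckerMinor_ne_zero (i : Fin 10) : pluckerMinor k i ≠ 0 := by
  intro h
  have h0 := degree_pluckerMinor k i
  rw [h, MonomialOrder.degree_zero] at h0
  have := DFunLike.congr_fun h0 (pluckerFst i)
  simp [pluckerExponent, Finsupp.single_apply] at this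
  omega

lemma aeval_pluckerMinor_monomial (m : Fin 10 →₀ ℕ) :
    aeval (pluckerMinor k) (monomial m (1 : k)) = ∏ i, pluckerMinor k i ^ m i := by
  rw [aeval_monomial, map_one, one_mul, Finsupp.prod_fintype _ _ fun _ ↦ pow_zero _]

lemma aeval_pluckerMinor_monomial_ne_zero (m : Fin 10 →₀ ℕ) :
    aeval (pluckerMinor k) (monomial m (1 : k)) ≠ 0 := by
  rw [aeval_pluckerMinor_monomial]
  exact Finset.prod_ne_zero_iff.2 fun i _ ↦ pow_ne_zero _ (pluckerMinor_ne_zero k i)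

lemma degree_aeval_pluckerMinor_monomial (m : Fin 10 →₀ ℕ) :
    MonomialOrder.lex.degree (aeval (pluckerMinor k) (monomial m (1 : k))) =
      ∑ i, m i • pluckerExponent i := by
  rw [aeval_pluckerMinor_monomial, MonomialOrder.degree_prod
    fun i _ ↦ pow_ne_zero _ (pluckerMinor_ne_zero k i)]
  exact Finset.sum_congr rfl fun i _ ↦ by rw [MonomialOrder.degree_pow, degree_pluckerMinor]

end

lemma injOn_sum_smul_pluckerExponent :
    Set.InjOn (fun m : Fin 10 →₀ ℕ ↦ ∑ i, m i • pluckerExponent i)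
      {m | IsStandardExponent m} := by
  intro m hm n hn h
  have h (j) := DFunLike.congr_fun h j
  simp only [pluckerExponent, Fin.sum_univ_succ, Finsupp.add_apply, Finsupp.smul_apply,
    Finsupp.single_apply, Fin.forall_fin_succ, pluckerFst, pluckerSnd] at h
  simp [Fin.ext_iff] at h
  have cases_chain {p : Fin 10 →₀ ℕ} (hp : IsStandardExponent p) :
      p 3 = 0 ∧ p 2 = 0 ∧ p 7 = 0 ∨ p 3 = 0 ∧ p 2 = 0 ∧ p 6 = 0 ∨
        p 3 = 0 ∧ p 9 = 0 ∧ p 7 = 0 ∨ p 3 = 0 ∧ p 9 = 0 ∧ p 6 = 0 ∨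
          p 9 = 0 ∧ p 8 = 0 ∧ p 6 = 0 := by
    unfold IsStandardExponent at hp
    tauto
  have h_eq : m 0 = n 0 ∧ m 1 = n 1 ∧ m 2 = n 2 ∧ m 3 = n 3 ∧ m 4 = n 4 ∧ m 5 = n 5 ∧
      m 6 = n 6 ∧ m 7 = n 7 ∧ m 8 = n 8 ∧ m 9 = n 9 := by
    rcases cases_chain hm with hm | hm | hm | hm | hm <;>
      rcases cases_chain hn with hn | hn | hn | hn | hn <;> omega
  ext i
  fin_cases i <;> simp [h_eq]

/-- Nonzero polynomials with pairwise distinct leading exponents are linearly independent. -/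
lemma MonomialOrder.linearIndependent_of_injective_degree {σ ι k : Type*} [Field k]
    (ord : MonomialOrder σ) {v : ι → MvPolynomial σ k} (hv : ∀ i, v i ≠ 0)
    (hinj : Function.Injective fun i ↦ ord.degree (v i)) : LinearIndependent k v := by
  classical
  rw [linearIndependent_iff']
  intro s g hg i hi
  by_contra hgi
  obtain ⟨j, hj, hmax⟩ := Finset.exists_max_image {j ∈ s | g j ≠ 0}
    (fun j ↦ ord.toSyn (ord.degree (v j))) ⟨i, by simp [hi, hgi]⟩
  rw [Finset.mem_filter] at hj
  have hcoeff := congrArg (coeff (ord.degree (v j))) hg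
  rw [coeff_sum, Finset.sum_eq_single_of_mem j hj.1, coeff_smul, coeff_zero] at hcoeff
  · exact mul_ne_zero hj.2 (ord.leadingCoeff_ne_zero_iff.2 (hv j)) hcoeff
  · intro l hl hlj
    rw [coeff_smul]
    by_cases hgl : g l = 0
    · rw [hgl, zero_smul]
    · rw [ord.coeff_eq_zero_of_lt, smul_zero]
      refine lt_of_le_of_ne (hmax l (by simp [hl, hgl])) fun h ↦ hlj (hinj ?_)
      exact ord.toSyn.injective h

section

variable (k : Type*) [Field k]

lemma coxIdeal5_le_ker :
    coxIdeal5 k ≤ RingHom.ker (aeval (R := k) (pluckerMinor k)) := by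
  rw [coxIdeal5, Ideal.span_le]
  rintro p (rfl | rfl | rfl | rfl | rfl) <;>
  · simp only [SetLike.mem_coe, RingHom.mem_ker, map_add, map_sub, map_mul, aeval_X,
      pluckerMinor, pluckerFst, pluckerSnd]
    simp
    ring

lemma linearIndependent_mk_monomial (t : ℕ) :
    LinearIndependent k fun m : standardExponents t ↦
      Ideal.Quotient.mkₐ k (coxIdeal5 k) (monomial (m : Fin 10 →₀ ℕ) (1 : k)) := by
  refine LinearIndependent.of_comp (Ideal.Quotient.liftₐ (coxIdeal5 k)
    (aeval (R := k) (pluckerMinor k)) (coxIdeal5_le_ker k)).toLinearMap ?_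
  have : LinearIndependent k fun m : standardExponents t ↦
      aeval (pluckerMinor k) (monomial (m : Fin 10 →₀ ℕ) (1 : k)) := by
    refine MonomialOrder.linearIndependent_of_injective_degree MonomialOrder.lex
      (fun m ↦ aeval_pluckerMinor_monomial_ne_zero k m) fun m n h ↦ ?_
    simp only [degree_aeval_pluckerMinor_monomial] at h
    exact Subtype.ext <| injOn_sum_smul_pluckerExponent (mem_standardExponents.1 m.2).2
      (mem_standardExponents.1 n.2).2 h
  exact this

/-- A weight for which, in each generator of the ideal, the nonstandard monomial is the
heaviest one. -/
def pluckerWeight : Fin 10 → ℕ := ![1, 4, 9, 16, 1, 4, 1, 9, 4, 1]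

variable {k} in
lemma exists_mk_monomial_eq_sub {m : Fin 10 →₀ ℕ} {a b : Fin 10} (c d e f : Fin 10)
    (hab : a ≠ b) (ha : m a ≠ 0) (hb : m b ≠ 0)
    (hrel : X a * X b - (X c * X d - X e * X f) ∈ coxIdeal5 k)
    (hcd : pluckerWeight c + pluckerWeight d < pluckerWeight a + pluckerWeight b)
    (hef : pluckerWeight e + pluckerWeight f < pluckerWeight a + pluckerWeight b) :
    ∃ m₁ m₂ : Fin 10 →₀ ℕ, m₁.degree = m.degree ∧ m₂.degree = m.degree ∧
      Finsupp.weight pluckerWeight m₁ < Finsupp.weight pluckerWeight m ∧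
      Finsupp.weight pluckerWeight m₂ < Finsupp.weight pluckerWeight m ∧
      Ideal.Quotient.mkₐ k (coxIdeal5 k) (monomial m (1 : k)) =
        Ideal.Quotient.mkₐ k (coxIdeal5 k) (monomial m₁ (1 : k)) -
          Ideal.Quotient.mkₐ k (coxIdeal5 k) (monomial m₂ (1 : k)) := by
  have hle : Finsupp.single a 1 + Finsupp.single b 1 ≤ m := fun i ↦ by
    simp only [Finsupp.add_apply, Finsupp.single_apply]
    grind
  obtain ⟨n, rfl⟩ := exists_add_of_le hle
  have hX (i j : Fin 10) : (monomial (Finsupp.single i 1 + Finsupp.single j 1 + n) (1 : k)) =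
      X i * X j * monomial n 1 := by
    simp [X, monomial_mul]
  refine ⟨Finsupp.single c 1 + Finsupp.single d 1 + n, Finsupp.single e 1 + Finsupp.single f 1 + n,
    by simp, by simp, by simpa [Finsupp.weight_single], by simpa [Finsupp.weight_single], ?_⟩
  rw [← map_sub, Ideal.Quotient.mkₐ_eq_mk, Ideal.Quotient.eq, hX, hX, hX]
  convert Ideal.mul_mem_right (monomial n 1) _ hrel using 1
  ring

lemma mk_monomial_mem_span {t : ℕ} {m : Fin 10 →₀ ℕ} (hm : m.degree = t) :
    Ideal.Quotient.mkₐ k (coxIdeal5 k) (monomial m (1 : k)) ∈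
      Submodule.span k (Set.range fun m : standardExponents t ↦
        Ideal.Quotient.mkₐ k (coxIdeal5 k) (monomial (m : Fin 10 →₀ ℕ) (1 : k))) := by
  induction hw : Finsupp.weight pluckerWeight m using Nat.strong_induction_on generalizing m with
  | _ w ih =>
    subst hw
    by_cases hstd : IsStandardExponent m
    · exact Submodule.subset_span ⟨⟨m, mem_standardExponents.2 ⟨hm, hstd⟩⟩, rfl⟩
    have hgen {p q : MvPolynomial (Fin 10) k}
        (hp : p ∈ ({X 4 * X 9 - X 5 * X 8 + X 6 * X 7, X 1 * X 4 - X 2 * X 5 + X 3 * X 6,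
          X 0 * X 4 - X 2 * X 7 + X 3 * X 8, X 0 * X 5 - X 1 * X 7 + X 3 * X 9,
          X 0 * X 6 - X 1 * X 8 + X 2 * X 9} : Set (MvPolynomial (Fin 10) k)))
        (hq : q = p) : q ∈ coxIdeal5 k := hq ▸ Ideal.subset_span hp
    obtain ⟨m₁, m₂, hm₁, hm₂, hlt₁, hlt₂, heq⟩ : ∃ m₁ m₂ : Fin 10 →₀ ℕ,
        m₁.degree = m.degree ∧ m₂.degree = m.degree ∧
        Finsupp.weight pluckerWeight m₁ < Finsupp.weight pluckerWeight m ∧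
        Finsupp.weight pluckerWeight m₂ < Finsupp.weight pluckerWeight m ∧
        Ideal.Quotient.mkₐ k (coxIdeal5 k) (monomial m (1 : k)) =
          Ideal.Quotient.mkₐ k (coxIdeal5 k) (monomial m₁ (1 : k)) -
            Ideal.Quotient.mkₐ k (coxIdeal5 k) (monomial m₂ (1 : k)) := by
      simp only [IsStandardExponent, not_and_or, not_or] at hstd
      rcases hstd with ⟨ha, hb⟩ | ⟨ha, hb⟩ | ⟨ha, hb⟩ | ⟨ha, hb⟩ | ⟨ha, hb⟩
      · exact exists_mk_monomial_eq_sub 1 8 0 6 (by decide) ha hb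
          (hgen (p := X 0 * X 6 - X 1 * X 8 + X 2 * X 9) (by simp) (by ring)) (by decide)
          (by decide)
      · exact exists_mk_monomial_eq_sub 1 7 0 5 (by decide) ha hb
          (hgen (p := X 0 * X 5 - X 1 * X 7 + X 3 * X 9) (by simp) (by ring)) (by decide)
          (by decide)
      · exact exists_mk_monomial_eq_sub 2 7 0 4 (by decide) ha hb
          (hgen (p := X 0 * X 4 - X 2 * X 7 + X 3 * X 8) (by simp) (by ring)) (by decide)
          (by decide)
      · exact exists_mk_monomial_eq_sub 2 5 1 4 (by decide) ha hb
          (hgen (p := X 1 * X 4 - X 2 * X 5 + X 3 * X 6) (by simp) (by ring)) (by decide)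
          (by decide)
      · exact exists_mk_monomial_eq_sub 5 8 4 9 (by decide) ha hb
          (hgen (p := X 4 * X 9 - X 5 * X 8 + X 6 * X 7) (by simp) (by ring)) (by decide)
          (by decide)
    rw [heq]
    exact Submodule.sub_mem _ (ih _ hlt₁ (hm₁.trans hm) rfl) (ih _ hlt₂ (hm₂.trans hm) rfl)

lemma map_homogeneousSubmodule_eq_span (t : ℕ) :
    (homogeneousSubmodule (Fin 10) k t).map
        (Ideal.Quotient.mkₐ k (coxIdeal5 k)).toLinearMap =
      Submodule.span k (Set.range fun m : standardExponents t ↦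
        Ideal.Quotient.mkₐ k (coxIdeal5 k) (monomial (m : Fin 10 →₀ ℕ) (1 : k))) := by
  apply le_antisymm
  · rw [Submodule.map_le_iff_le_comap]
    intro p hp
    rw [Submodule.mem_comap, p.as_sum, map_sum]
    refine Submodule.sum_mem _ fun m hm ↦ ?_
    rw [← mul_one (coeff m p), ← smul_eq_mul, ← smul_monomial, map_smul]
    refine Submodule.smul_mem _ _ (mk_monomial_mem_span k ?_)
    by_contra h
    exact mem_support_iff.1 hm (((mem_homogeneousSubmodule t p).1 hp).coeff_eq_zero h)
  · rw [Submodule.span_le]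
    rintro _ ⟨m, rfl⟩
    exact Submodule.mem_map_of_mem (f := (Ideal.Quotient.mkₐ k (coxIdeal5 k)).toLinearMap)
      (isHomogeneous_monomial 1 (mem_standardExponents.1 m.2).1)

end

/-- The Hilbert function of the Cox ring of the degree-5 del Pezzo surface: for
every `t ≥ 0`, the dimension of the degree-`t` graded piece of `R/I` (the image
in `R/I` of the homogeneous degree-`t` polynomials) is
`(5t⁶ + 75t⁵ + 455t⁴ + 1425t³ + 2420t² + 2100t + 720)/720`. -/
theorem coxRing5_hilbert_function (k : Type*) [Field k] [CharZero k] (t : ℕ) :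
    720 * Module.finrank k
        ↥((homogeneousSubmodule (Fin 10) k t).map
            (Ideal.Quotient.mkₐ k (coxIdeal5 k)).toLinearMap) =
      5 * t ^ 6 + 75 * t ^ 5 + 455 * t ^ 4 + 1425 * t ^ 3 + 2420 * t ^ 2 +
        2100 * t + 720 := by
  rw [map_homogeneousSubmodule_eq_span, finrank_span_eq_card (linearIndependent_mk_monomial k t),
    Fintype.card_coe, mul_card_standardExponents]
end

section
/- Let k be a field of characteristic zero, let R = k[x₁, x₂, x₃, x₄, y₁₂, y₁₃, y₁₄, y₂₃, y₂₄, y₃₄], and let I ⊂ R be the ideal generated by the five quadrics y₁₂y₃₄ − y₁₃y₂₄ + y₁₄y₂₃, x₂y₁₂ − x₃y₁₃ + x₄y₁₄, x₁y₁₂ − x₃y₂₃ + x₄y₂₄, x₁y₁₃ − x₂y₂₃ + x₄y₃₄, x₁y₁₄ − x₂y₂₄ + x₃y₃₄. Then the Krull dimension of the quotient ring R/I equals 7. -/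
open MvPolynomial

/-- An integral extension does not raise the Krull dimension. -/
theorem ringKrullDim_le_of_isIntegral (A B : Type*) [CommRing A] [CommRing B] [Algebra A B]
    [Algebra.IsIntegral A B] : ringKrullDim B ≤ ringKrullDim A :=
  Order.krullDim_le_of_strictMono (PrimeSpectrum.comap (algebraMap A B)) fun P _ hPQ ↦
    Ideal.IsIntegral.comap_lt_comap (I := P.asIdeal) hPQ

/-- An affine slice of the Plücker relations of `Gr(2,5)`: fixing the sums of the Plücker
coordinates along the ranks of the Plücker poset leaves three coordinates `c`, `d`, `e`, which
are integral because the span of `1, c, d, e, ce` is closed under multiplication by each. -/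
theorem isIntegral_of_pluecker_slice {A B : Type*} [CommRing A] [CommRing B] [Algebra A B]
    (a b s t u f g : A) (c d e : B)
    (hcc : c * c = algebraMap A B s * c - algebraMap A B b * (algebraMap A B t - d)
      + algebraMap A B a * (algebraMap A B u - e))
    (hcd : c * d = algebraMap A B s * d + algebraMap A B a * algebraMap A B f
      - algebraMap A B b * e)
    (hdd : d * d = algebraMap A B a * algebraMap A B g - c * e + algebraMap A B t * d)
    (hde : d * e = algebraMap A B b * algebraMap A B g - algebraMap A B f * c
      + algebraMap A B u * d)
    (hee : e * e = (algebraMap A B s - c) * algebraMap A B g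
      - (algebraMap A B t - d) * algebraMap A B f + algebraMap A B u * e) :
    IsIntegral A c ∧ IsIntegral A d ∧ IsIntegral A e := by
  set N : Submodule A B := Submodule.span A {1, c, d, e, c * e} with hN
  have mem (p₀ p₁ p₂ p₃ p₄ : A) (z : B)
      (hz : z = algebraMap A B p₀ + algebraMap A B p₁ * c + algebraMap A B p₂ * d
        + algebraMap A B p₃ * e + algebraMap A B p₄ * (c * e)) : z ∈ N := by
    have h₀ : (1 : B) ∈ N := Submodule.subset_span (by simp)
    have h₁ : c ∈ N := Submodule.subset_span (by simp)
    have h₂ : d ∈ N := Submodule.subset_span (by simp)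
    have h₃ : e ∈ N := Submodule.subset_span (by simp)
    have h₄ : c * e ∈ N := Submodule.subset_span (by simp)
    have := N.add_mem (N.add_mem (N.add_mem (N.add_mem (N.smul_mem p₀ h₀) (N.smul_mem p₁ h₁))
      (N.smul_mem p₂ h₂)) (N.smul_mem p₃ h₃)) (N.smul_mem p₄ h₄)
    simpa only [Algebra.smul_def, mul_one, hz] using this
  have closed (z : B) (h₀ : z * 1 ∈ N) (h₁ : z * c ∈ N) (h₂ : z * d ∈ N) (h₃ : z * e ∈ N)
      (h₄ : z * (c * e) ∈ N) : ∀ n ∈ N, z * n ∈ N := by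
    have hle : N ≤ N.comap (LinearMap.mulLeft A z) := by
      rw [hN, Submodule.span_le, ← hN]
      rintro w (rfl | rfl | rfl | rfl | rfl) <;> assumption
    exact fun n hn ↦ hle hn
  have hc : ∀ n ∈ N, c * n ∈ N := by
    refine closed c ?_ ?_ ?_ ?_ ?_
    · exact mem 0 1 0 0 0 _ (by simp)
    · exact mem (a * u - b * t) s b (-a) 0 _ (by simp; linear_combination hcc)
    · exact mem (a * f) 0 s (-b) 0 _ (by simp; linear_combination hcd)
    · exact mem 0 0 0 0 1 _ (by simp)
    · exact mem (b * b * g - a * (s * g - t * f)) (a * g - b * f) (b * u - a * f) (-b * t) s _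
        (by simp; linear_combination e * hcc + algebraMap A B b * hde - algebraMap A B a * hee)
  have hd : ∀ n ∈ N, d * n ∈ N := by
    refine closed d ?_ ?_ ?_ ?_ ?_
    · exact mem 0 0 1 0 0 _ (by simp)
    · exact mem (a * f) 0 s (-b) 0 _ (by simp; linear_combination hcd)
    · exact mem (a * g) 0 t 0 (-1) _ (by simp; linear_combination hdd)
    · exact mem (b * g) (-f) u 0 0 _ (by simp; linear_combination hde)
    · exact mem (b * t * f) (b * g - s * f) (s * u - b * f) (a * f - b * u) 0 _
        (by simp; linear_combination e * hcd + algebraMap A B s * hde - algebraMap A B b * hee)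
  have he : ∀ n ∈ N, e * n ∈ N := by
    refine closed e ?_ ?_ ?_ ?_ ?_
    · exact mem 0 0 0 1 0 _ (by simp)
    · exact mem 0 0 0 0 1 _ (by simp; ring)
    · exact mem (b * g) (-f) u 0 0 _ (by simp; linear_combination hde)
    · exact mem (s * g - t * f) (-g) f u 0 _ (by simp; linear_combination hee)
    · exact mem (g * b * t - g * a * u + a * f * f) (-t * f) (f * s - g * b) (g * a - f * b) u _
        (by simp; linear_combination c * hee - algebraMap A B g * hcc + algebraMap A B f * hcd)
  have h_one : (1 : B) ∈ N := Submodule.subset_span (by simp)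
  have h_mul (x y : B) (hx : x ∈ N) (hy : y ∈ N) : x * y ∈ N := by
    refine mul_comm y x ▸ closed y ?_ ?_ ?_ ?_ ?_ x hx
    · simpa using hy
    · exact mul_comm c y ▸ hc y hy
    · exact mul_comm d y ▸ hd y hy
    · exact mul_comm e y ▸ he y hy
    · simpa only [mul_comm y, mul_assoc] using hc _ (he y hy)
  have integral (z : B) (hz : z ∈ N) : IsIntegral A z :=
    .of_mem_of_fg (N.toSubalgebra h_one h_mul) (Submodule.fg_span (Set.toFinite _)) z hz
  exact ⟨integral c (Submodule.subset_span (by simp)), integral d (Submodule.subset_span (by simp)),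
    integral e (Submodule.subset_span (by simp))⟩

theorem coxIdeal5_eq_zero {k S : Type*} [Field k] [CommRing S]
    (φ : CoxRing5Ambient k →+* S) (hφ : coxIdeal5 k ≤ RingHom.ker φ) :
    φ (X 4) * φ (X 9) - φ (X 5) * φ (X 8) + φ (X 6) * φ (X 7) = 0 ∧
    φ (X 1) * φ (X 4) - φ (X 2) * φ (X 5) + φ (X 3) * φ (X 6) = 0 ∧
    φ (X 0) * φ (X 4) - φ (X 2) * φ (X 7) + φ (X 3) * φ (X 8) = 0 ∧
    φ (X 0) * φ (X 5) - φ (X 1) * φ (X 7) + φ (X 3) * φ (X 9) = 0 ∧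
    φ (X 0) * φ (X 6) - φ (X 1) * φ (X 8) + φ (X 2) * φ (X 9) = 0 := by
  simpa [coxIdeal5, Ideal.span_le, Set.insert_subset_iff, RingHom.mem_ker] using hφ

theorem ringKrullDim_le_of_coxIdeal5_le_ker {k B : Type*} [Field k] [CommRing B] [Algebra k B]
    (π : CoxRing5Ambient k →ₐ[k] B) (hsurj : Function.Surjective π)
    (hker : coxIdeal5 k ≤ RingHom.ker (π : CoxRing5Ambient k →+* B)) : ringKrullDim B ≤ 7 := by
  let θ : Fin 7 → B := ![π (X 0), π (X 1), π (X 2) + π (X 9), π (X 3) + π (X 8),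
    π (X 7) + π (X 6), π (X 5), π (X 4)]
  let _ : Algebra (MvPolynomial (Fin 7) k) B :=
    (aeval θ : MvPolynomial (Fin 7) k →ₐ[k] B).toRingHom.toAlgebra
  have halg (p : MvPolynomial (Fin 7) k) :
    algebraMap (MvPolynomial (Fin 7) k) B p = aeval θ p := rfl
  obtain ⟨h₁, h₂, h₃, h₄, h₅⟩ := coxIdeal5_eq_zero (π : CoxRing5Ambient k →+* B) hker
  simp only [RingHom.coe_coe] at h₁ h₂ h₃ h₄ h₅
  obtain ⟨hc, hd, he⟩ := isIntegral_of_pluecker_slice (A := MvPolynomial (Fin 7) k)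
    (X 0) (X 1) (X 2) (X 3) (X 4) (X 5) (X 6) (π (X 2)) (π (X 3)) (π (X 7))
    (by simp [halg, θ]; linear_combination -h₅) (by simp [halg, θ]; linear_combination -h₄)
    (by simp [halg, θ]; linear_combination -h₃) (by simp [halg, θ]; linear_combination -h₂)
    (by simp [halg, θ]; linear_combination -h₁)
  have hθ (i : Fin 7) : IsIntegral (MvPolynomial (Fin 7) k) (θ i) := by
    simpa only [halg, aeval_X] using
      isIntegral_algebraMap (R := MvPolynomial (Fin 7) k) (A := B) (x := X i)
  have hX (i : Fin 10) : IsIntegral (MvPolynomial (Fin 7) k) (π (X i)) := by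
    fin_cases i
    · exact hθ 0
    · exact hθ 1
    · exact hc
    · exact hd
    · exact hθ 6
    · exact hθ 5
    · simpa [θ] using (hθ 4).sub he
    · exact he
    · simpa [θ] using (hθ 3).sub hd
    · simpa [θ] using (hθ 2).sub hc
  have : Algebra.IsIntegral (MvPolynomial (Fin 7) k) B := by
    refine ⟨fun x ↦ ?_⟩
    obtain ⟨p, rfl⟩ := hsurj x
    induction p using MvPolynomial.induction_on with
    | C r =>
      have := isIntegral_algebraMap (R := MvPolynomial (Fin 7) k) (A := B) (x := C r)
      rwa [halg, algHom_C, ← π.commutes, algebraMap_eq] at this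
    | add p q hp hq => exact map_add π p q ▸ hp.add hq
    | mul_X p i hp => exact map_mul π p (X i) ▸ hp.mul (hX i)
  simpa using ringKrullDim_le_of_isIntegral (MvPolynomial (Fin 7) k) B

theorem ringKrullDim_quotient_coxIdeal5_le (k : Type*) [Field k] :
    ringKrullDim (CoxRing5Ambient k ⧸ coxIdeal5 k) ≤ 7 :=
  ringKrullDim_le_of_coxIdeal5_le_ker (Ideal.Quotient.mkₐ k (coxIdeal5 k))
    (Ideal.Quotient.mkₐ_surjective k _) (Ideal.mk_ker (I := coxIdeal5 k)).ge

/-- The point of the affine cone over `Gr(2,5)` with `x = (v₀, v₁, v₂, v₃)` whose remaining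
coordinates come from the chart `x₁ ≠ 0`, with denominators cleared. -/
def coxPoint5 {S : Type*} [CommRing S] (v : Fin 7 → S) : Fin 10 → S :=
  ![v 0, v 1, v 2, v 3, v 2 * v 4 - v 3 * v 5, v 1 * v 4 - v 3 * v 6, v 1 * v 5 - v 2 * v 6,
    v 0 * v 4, v 0 * v 5, v 0 * v 6]

theorem map_coxPoint5 {S T : Type*} [CommRing S] [CommRing T] (f : S →+* T) (v : Fin 7 → S)
    (i : Fin 10) : f (coxPoint5 v i) = coxPoint5 (f ∘ v) i := by
  fin_cases i <;> simp [coxPoint5]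

/-- The variables `v₀, …, v₆`, with those of index at least `7 - j` replaced by zero. -/
noncomputable def truncatedVars (k : Type*) [Field k] (j : Fin 8) (i : Fin 7) :
    MvPolynomial (Fin 7) k :=
  if (i : ℕ) + j < 7 then X i else 0

/-- The parametrization of the cone over `Gr(2,5)`, restricted to a coordinate subspace. -/
noncomputable def coxParam5 (k : Type*) [Field k] (j : Fin 8) :
    CoxRing5Ambient k ⧸ coxIdeal5 k →ₐ[k] MvPolynomial (Fin 7) k :=
  Ideal.Quotient.liftₐ (coxIdeal5 k) (aeval (coxPoint5 (truncatedVars k j))) <| by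
    change coxIdeal5 k ≤ RingHom.ker (aeval (coxPoint5 (truncatedVars k j)))
    rw [coxIdeal5, Ideal.span_le]
    rintro p (rfl | rfl | rfl | rfl | rfl) <;> simp [coxPoint5, RingHom.mem_ker] <;> ring

theorem coxParam5_mk_X (k : Type*) [Field k] (j : Fin 8) (i : Fin 10) :
    coxParam5 k j (Ideal.Quotient.mk _ (X i)) = coxPoint5 (truncatedVars k j) i := by
  change aeval (coxPoint5 (truncatedVars k j)) (X i) = _
  simp

theorem coxParam5_eq_comp (k : Type*) [Field k] {j l : Fin 8} (hjl : j ≤ l) :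
    coxParam5 k l = (aeval (truncatedVars k l)).comp (coxParam5 k j) := by
  refine Ideal.Quotient.algHom_ext _ (MvPolynomial.algHom_ext fun i ↦ ?_)
  change coxParam5 k l (Ideal.Quotient.mk _ (X i)) =
    aeval (truncatedVars k l) (coxParam5 k j (Ideal.Quotient.mk _ (X i)))
  rw [coxParam5_mk_X, coxParam5_mk_X, ← RingHom.coe_coe, map_coxPoint5]
  congr 1
  funext m
  simp only [truncatedVars, Function.comp_apply, RingHom.coe_coe]
  split_ifs <;> first | (exfalso; lia) | simp_all [truncatedVars]

theorem ker_coxParam5_lt (k : Type*) [Field k] (j : Fin 7) :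
    RingHom.ker (coxParam5 k j.castSucc) < RingHom.ker (coxParam5 k j.succ) := by
  refine SetLike.lt_iff_le_and_exists.mpr ⟨fun p hp ↦ ?_, ?_⟩
  · rw [RingHom.mem_ker] at hp ⊢
    rw [coxParam5_eq_comp k (Fin.castSucc_lt_succ (i := j)).le, AlgHom.comp_apply, hp, map_zero]
  · refine ⟨Ideal.Quotient.mk _ (X (![9, 8, 7, 3, 2, 1, 0] j)), ?_⟩
    rw [RingHom.mem_ker, RingHom.mem_ker, coxParam5_mk_X, coxParam5_mk_X]
    fin_cases j <;> simp [coxPoint5, truncatedVars]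

theorem le_ringKrullDim_quotient_coxIdeal5 (k : Type*) [Field k] :
    7 ≤ ringKrullDim (CoxRing5Ambient k ⧸ coxIdeal5 k) :=
  Order.LTSeries.length_le_krullDim (α := PrimeSpectrum (CoxRing5Ambient k ⧸ coxIdeal5 k))
    { length := 7
      toFun := fun j ↦ ⟨RingHom.ker (coxParam5 k j), RingHom.ker_isPrime _⟩
      step := ker_coxParam5_lt k }

/-- The Krull dimension of the Cox ring `R/I` of the degree-5 del Pezzo
surface is `7`. -/
theorem coxRing5_krullDim (k : Type*) [Field k] [CharZero k] :
    ringKrullDim (CoxRing5Ambient k ⧸ coxIdeal5 k) = 7 := by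
  exact le_antisymm (ringKrullDim_quotient_coxIdeal5_le k) (le_ringKrullDim_quotient_coxIdeal5 k)
end
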